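/- Let 1 < p < 2 and 1/p + 1/q = 1 (so q > 2). There exist constants c₁, c₂ > 0 depending only on n and p such that for every γ ≥ 1 and every x ∈ ℝⁿ, c₁ e^{γ|x|^p/p} ≤ ∫_{ℝⁿ} e^{γ^{1/p} λ·x − |λ|^q/q} |λ|^{n(q−2)/2} dλ ≤ c₂ e^{γ|x|^p/p}. -/

import Mathlib

open MeasureTheory Real Filter


open MeasureTheory Real Filter

noncomputable section

abbrev Euc (n : ℕ) := EuclideanSpace ℝ (Fin n)

/-- Partial derivative `∂_{x_j} f` of a complex-valued function. -/
def pdC {n : ℕ} (j : Fin n) (f : Euc n → ℂ) (x : Euc n) : ℂ :=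
  fderiv ℝ f x (EuclideanSpace.single j 1)

/-- Partial derivative `∂_{x_j} f` of a real-valued function. -/
def pdR {n : ℕ} (j : Fin n) (f : Euc n → ℝ) (x : Euc n) : ℝ :=
  fderiv ℝ f x (EuclideanSpace.single j 1)

/-- Magnetic derivative `(∇_A f)_j = ∂_{x_j} f - i A_j f`. -/
def magD {n : ℕ} (A : Euc n → Euc n) (j : Fin n) (f : Euc n → ℂ) (x : Euc n) : ℂ :=
  pdC j f x - Complex.I * (A x j : ℂ) * f x

/-- Magnetic Laplacian `Δ_A = (∇ - iA)²`. -/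
def magLap {n : ℕ} (A : Euc n → Euc n) (f : Euc n → ℂ) (x : Euc n) : ℂ :=
  ∑ j, magD A j (magD A j f) x

/-- Magnetic field `B = DA - DAᵗ`, `B_{jk} = ∂_{x_j} A_k - ∂_{x_k} A_j`. -/
def Bfield {n : ℕ} (A : Euc n → Euc n) (x : Euc n) (j k : Fin n) : ℝ :=
  pdR j (fun y => A y k) x - pdR k (fun y => A y j) x

/-- `Ψ(x) = xᵗ B(x)`. -/
def PsiB {n : ℕ} (A : Euc n → Euc n) (x : Euc n) (k : Fin n) : ℝ :=
  ∑ j, x j * Bfield A x j k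

/-- `Θ(x) = ∫₀¹ Ψ(sx) ds`. -/
def ThetaB {n : ℕ} (A : Euc n → Euc n) (x : Euc n) (k : Fin n) : ℝ :=
  ∫ s in (0:ℝ)..1, PsiB A (s • x) k

lemma tang {r x y : ℝ} (hr : 1 < r) (hx : 0 ≤ x) (hy : 0 ≤ y) :
    y^r + r * y^(r-1) * (x - y) ≤ x^r := by
  rcases hy.eq_or_lt with rfl | hy
  · rw [zero_rpow (by linarith), zero_rpow (by linarith)]
    have := rpow_nonneg hx r
    simpa using this
  · have h := one_add_mul_self_le_rpow_one_add (s := x/y - 1) (by have := div_nonneg hx hy.le; linarith) hr.le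
    rw [add_sub_cancel, div_rpow hx hy.le, le_div_iff₀ (rpow_pos_of_pos hy r)] at h
    have e : y^r = y^(r-1) * y := by
      rw [← rpow_add_one hy.ne']; congr 1; ring
    calc _ = (1 + r * (x/y - 1)) * y^r := by rw [e]; field_simp
      _ ≤ _ := h

/-- Lower bound for the radial divergence. -/
lemma rad_lower {q a b : ℝ} (hq : 2 < q) (ha : 0 ≤ a) (hb : 0 ≤ b) :
    b^(q-2) * (a-b)^2 / 2 ≤ a^q/q + b^q*(1-1/q) - b^(q-2)*b*a := by
  have h := tang (r := q/2) (x := a^2) (y := b^2) (by linarith) (by positivity) (by positivity)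
  have e1 : (a^2)^(q/2) = a^q := by
    rw [← rpow_natCast, ← rpow_mul ha]; congr 1; push_cast; ring
  have e2 : (b^2)^(q/2) = b^q := by
    rw [← rpow_natCast, ← rpow_mul hb]; congr 1; push_cast; ring
  have e3 : (b^2)^(q/2-1) = b^(q-2) := by
    rw [← rpow_natCast, ← rpow_mul hb]; congr 1; push_cast; ring
  rw [e1, e2, e3] at h
  have e4 : b^q = b^(q-2) * b^2 := by
    rw [← rpow_natCast, ← rpow_add_of_nonneg hb (by linarith) (by norm_num)]; congr 1; push_cast; ring
  have h2 : (b^q + q/2 * b^(q-2) * (a^2-b^2))/q ≤ a^q/q := by gcongr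
  have h3 : (b^q + q/2 * b^(q-2) * (a^2-b^2))/q = b^q/q + b^(q-2)*(a^2-b^2)/2 := by
    field_simp
  have h4 : b^q*(1-1/q) = b^(q-2) * b^2 - b^q/q := by rw [← e4]; ring
  rw [h4]
  nlinarith

lemma rad_upper {q a b : ℝ} (hq : 2 < q) (ha : 0 ≤ a) (hb : 0 ≤ b) (hab : a ≤ 2*b) :
    a^q/q + b^q*(1-1/q) - b^(q-2)*b*a ≤ (q-1)*2^(q-2) * b^(q-2) * (a-b)^2 := by
  have h := tang (r := q) (x := b) (y := a) (by linarith) hb ha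
  have pw : ∀ c : ℝ, 0 ≤ c → c^q = c^(q-1) * c := fun c hc => by
    rw [← rpow_add_one' hc (by linarith)]; congr 1; ring
  have pw2 : ∀ c : ℝ, 0 ≤ c → c^(q-1) = c^(q-2) * c := fun c hc => by
    rw [← rpow_add_one' hc (by linarith)]; congr 1; ring
  rw [← pw2 b hb]
  have h2 : (a^q + q * a^(q-1) * (b-a))/q ≤ b^q/q := by gcongr
  have h3 : (a^q + q * a^(q-1) * (b-a))/q = a^q/q + a^(q-1)*(b-a) := by
    field_simp
  have h4 : a^q/q + b^q*(1-1/q) - b^(q-1)*a ≤ (a^(q-1) - b^(q-1))*(a-b) := by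
    have : b^q*(1-1/q) = b^(q-1)*b - b^q/q := by rw [← pw b hb]; ring
    nlinarith
  refine h4.trans ?_
  have hT : (2*b)^(q-2) = 2^(q-2) * b^(q-2) := mul_rpow (by norm_num) hb
  have hA : a^(q-2) ≤ 2^(q-2) * b^(q-2) := by
    rw [← hT]; exact rpow_le_rpow ha hab (by linarith)
  have hB : b^(q-2) ≤ 2^(q-2) * b^(q-2) := by
    rw [← hT]; exact rpow_le_rpow hb (by linarith) (by linarith)
  have e : q - 1 - 1 = q - 2 := by ring
  rcases le_total b a with hba | hba
  · have t := tang (r := q-1) (x := b) (y := a) (by linarith) hb ha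
    rw [e] at t
    calc _ ≤ ((q-1) * a^(q-2) * (a-b)) * (a-b) :=
          mul_le_mul_of_nonneg_right (by linarith) (by linarith)
      _ = (q-1) * a^(q-2) * (a-b)^2 := by ring
      _ ≤ (q-1) * (2^(q-2) * b^(q-2)) * (a-b)^2 := by
          gcongr; linarith
      _ = _ := by ring
  · have t := tang (r := q-1) (x := a) (y := b) (by linarith) ha hb
    rw [e] at t
    calc (a^(q-1) - b^(q-1))*(a-b) = (b^(q-1) - a^(q-1))*(b-a) := by ring
      _ ≤ ((q-1) * b^(q-2) * (b-a)) * (b-a) :=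
          mul_le_mul_of_nonneg_right (by linarith) (by linarith)
      _ = (q-1) * b^(q-2) * (a-b)^2 := by ring
      _ ≤ (q-1) * (2^(q-2) * b^(q-2)) * (a-b)^2 := by
          gcongr; linarith
      _ = _ := by ring

/-- Bregman divergence. -/
def DD {n : ℕ} (q : ℝ) (m l : Euc n) : ℝ :=
  ‖l‖^q/q + ‖m‖^q*(1-1/q) - ‖m‖^(q-2) * inner ℝ l m

lemma DD_eq {n : ℕ} (q : ℝ) (m l : Euc n) : DD q m l =
    (‖l‖^q/q + ‖m‖^q*(1-1/q) - ‖m‖^(q-2)*‖m‖*‖l‖) + ‖m‖^(q-2)*(‖l‖*‖m‖ - inner ℝ l m) := by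
  unfold DD; ring

lemma DD_lower {n : ℕ} {q : ℝ} (hq : 2 < q) (m l : Euc n) :
    ‖m‖^(q-2) * ‖l - m‖^2 / 2 ≤ DD q m l := by
  have h := rad_lower hq (norm_nonneg l) (norm_nonneg m)
  rw [DD_eq, norm_sub_sq_real]
  linarith

lemma DD_upper {n : ℕ} {q : ℝ} (hq : 2 < q) (m l : Euc n) (hlm : ‖l‖ ≤ 2 * ‖m‖) :
    DD q m l ≤ ((q-1)*2^(q-2) + 1) * (‖m‖^(q-2) * ‖l - m‖^2) := by
  have h := rad_upper hq (norm_nonneg l) (norm_nonneg m) hlm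
  have hc := real_inner_le_norm l m
  have hb : 0 ≤ ‖m‖^(q-2) := by positivity
  have e : ‖l - m‖^2 = (‖l‖-‖m‖)^2 + 2*(‖l‖*‖m‖ - inner ℝ l m) := by
    rw [norm_sub_sq_real]; ring
  have hK : 0 ≤ (q-1)*2^(q-2) := mul_nonneg (by linarith) (by positivity)
  rw [DD_eq, e]
  set X := ‖l‖*‖m‖ - inner ℝ l m with hX
  have hX0 : 0 ≤ X := by linarith
  have h1 : 0 ≤ (q-1)*2^(q-2) * (‖m‖^(q-2) * X) := by positivity
  have h2 : 0 ≤ ‖m‖^(q-2) * X := by positivity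
  have h3 : 0 ≤ ‖m‖^(q-2) * (‖l‖-‖m‖)^2 := by positivity
  nlinarith

lemma DD_small {n : ℕ} {q : ℝ} (hq : 2 < q) (m l : Euc n) (hm : ‖m‖ ≤ 1) (hl : ‖l‖ ≤ 1) :
    DD q m l ≤ 3 := by
  have a1 : ‖l‖^q ≤ 1 := rpow_le_one (norm_nonneg _) hl (by linarith)
  have a2 : ‖m‖^q ≤ 1 := rpow_le_one (norm_nonneg _) hm (by linarith)
  have a3 : ‖m‖^(q-2) ≤ 1 := rpow_le_one (norm_nonneg _) hm (by linarith)
  have b2 : 0 ≤ ‖m‖^q := by positivity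
  have b3 : 0 ≤ ‖m‖^(q-2) := by positivity
  have hc := abs_real_inner_le_norm l m
  have hc2 : ‖l‖*‖m‖ ≤ 1 := mul_le_one₀ hl (norm_nonneg _) hm
  have hc3 := (abs_le.1 (hc.trans hc2)).1
  have d1 : ‖l‖^q/q ≤ 1 := by rw [div_le_one (by linarith)]; linarith
  have d2 : ‖m‖^q*(1-1/q) ≤ 1 := by
    have : 0 < 1/q := by positivity
    nlinarith
  unfold DD
  nlinarith

lemma DD_far {n : ℕ} {q : ℝ} (hq : 2 < q) (m l : Euc n) (hlm : 2*q*‖m‖ ≤ ‖l‖) :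
    ‖l‖^q/(2*q) ≤ DD q m l := by
  have hc := real_inner_le_norm l m
  have hb : 0 ≤ ‖m‖^(q-2) := by positivity
  have hq1 : 1/q ≤ 1 := by rw [div_le_one (by linarith)]; linarith
  have h0 : 0 ≤ ‖m‖^q*(1-1/q) := mul_nonneg (by positivity) (by linarith)
  have h1 : ‖m‖^(q-2) ≤ ‖l‖^(q-2) :=
    rpow_le_rpow (norm_nonneg _) (by nlinarith [norm_nonneg m]) (by linarith)
  have e : ‖l‖^q = ‖l‖^(q-2) * ‖l‖^2 := by
    rw [← rpow_natCast, ← rpow_add_of_nonneg (norm_nonneg l) (by linarith) (by norm_num)]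
    congr 1; push_cast; ring
  have h2 : ‖m‖^(q-2) * inner ℝ l m ≤ ‖l‖^q/(2*q) := by
    calc _ ≤ ‖m‖^(q-2) * (‖l‖*‖m‖) := by gcongr
      _ ≤ ‖l‖^(q-2) * (‖l‖*‖m‖) := by gcongr
      _ ≤ ‖l‖^(q-2) * (‖l‖*(‖l‖/(2*q))) := by
          gcongr; rw [le_div_iff₀ (by linarith)]; linarith
      _ = _ := by rw [e]; ring
  have e2 : ‖l‖^q/q = ‖l‖^q/(2*q) + ‖l‖^q/(2*q) := by field_simp; norm_num
  unfold DD
  linarith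

lemma int_rad {n : ℕ} (hn : 1 ≤ n) {q c α : ℝ} (hq : 0 < q) (hc : 0 < c) (hα : 0 ≤ α) :
    Integrable (fun l : Euc n => rexp (-c * ‖l‖^q) * ‖l‖^α) := by
  have : NeZero n := ⟨by omega⟩
  have : Nontrivial (Euc n) := by
    have : Nonempty (Fin n) := ⟨0⟩
    infer_instance
  rw [integrable_fun_norm_addHaar (volume : Measure (Euc n)) (f := fun t : ℝ => rexp (-c * t^q) * t^α)]
  rw [finrank_euclideanSpace_fin]
  have h := integrableOn_rpow_mul_exp_neg_mul_rpow (p := q) (s := ((n-1 : ℕ) : ℝ) + α) (b := c)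
    (by have : (0:ℝ) ≤ ((n-1:ℕ):ℝ) := by positivity
        linarith) hq hc
  refine h.congr_fun (fun t ht => ?_) measurableSet_Ioi
  have ht : 0 < t := ht
  simp only [smul_eq_mul]
  rw [rpow_add ht, rpow_natCast]; ring

lemma gauss_scaled {n : ℕ} {s : ℝ} (hs : 0 < s) (m : Euc n) :
    Integrable (fun l : Euc n => rexp (-(s^2 * ‖l - m‖^2 / 2))) ∧
    s^n * ∫ l : Euc n, rexp (-(s^2 * ‖l - m‖^2 / 2)) = ∫ l : Euc n, rexp (-(1/2) * ‖l‖^2) := by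
  have h0 : Integrable (fun l : Euc n => rexp (-(1/2) * ‖l‖^2)) := by
    refine Integrable.of_integral_ne_zero ?_
    rw [GaussianFourier.integral_rexp_neg_mul_sq_norm (by norm_num)]
    positivity
  have e : ∀ l : Euc n, rexp (-(s^2 * ‖l - m‖^2 / 2)) =
      (fun v : Euc n => (fun l : Euc n => rexp (-(1/2) * ‖l‖^2)) (s • v)) (l - m) := by
    intro l
    simp only [norm_smul, Real.norm_eq_abs, mul_pow, sq_abs]
    congr 1; ring
  simp_rw [e]
  constructor
  · exact (h0.comp_smul hs.ne').comp_sub_right m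
  · rw [integral_sub_right_eq_self (fun v : Euc n => (fun l : Euc n => rexp (-(1/2) * ‖l‖^2)) (s • v)) m,
      Measure.integral_comp_smul volume (fun l : Euc n => rexp (-(1/2) * ‖l‖^2)) s, finrank_euclideanSpace_fin, abs_of_pos (by positivity), smul_eq_mul,
      ← mul_assoc, mul_inv_cancel₀ (by positivity), one_mul]

lemma ball_lower {n : ℕ} (hn : 1 ≤ n) {f : Euc n → ℝ} (hf : Integrable f) (h0 : ∀ l, 0 ≤ f l)
    (c : Euc n) {r k : ℝ} (hr : 0 ≤ r) (hk : ∀ l ∈ Metric.ball c r, k ≤ f l) :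
    k * (r^n * volume.real (Metric.ball (0 : Euc n) 1)) ≤ ∫ l, f l := by
  have : NeZero n := ⟨by omega⟩
  have : Nontrivial (Euc n) := by
    have : Nonempty (Fin n) := ⟨0⟩
    infer_instance
  have e : volume.real (Metric.ball c r) = r^n * volume.real (Metric.ball (0 : Euc n) 1) := by
    rw [measureReal_def, Measure.addHaar_ball _ _ hr, ENNReal.toReal_mul,
      ENNReal.toReal_ofReal (by positivity), finrank_euclideanSpace_fin, measureReal_def]
  rw [← e]
  refine (setIntegral_ge_of_const_le_real Metric.isOpen_ball.measurableSet measure_ball_lt_top.ne hk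
    hf.integrableOn).trans ?_
  exact setIntegral_le_integral hf (Eventually.of_forall h0)

lemma DD_cont {n : ℕ} {q : ℝ} (hq : 2 < q) (m : Euc n) : Continuous (DD q m) := by
  unfold DD
  have : Continuous (fun l : Euc n => ‖l‖^q) :=
    continuous_norm.rpow_const (fun _ => Or.inr (by linarith))
  fun_prop

lemma core_upper {n : ℕ} (hn : 1 ≤ n) {q : ℝ} (hq : 2 < q) :
    ∃ C > (0:ℝ), ∀ m : Euc n,
      Integrable (fun l : Euc n => rexp (-DD q m l) * ‖l‖^((n:ℝ)*(q-2)/2)) ∧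
      ∫ l : Euc n, rexp (-DD q m l) * ‖l‖^((n:ℝ)*(q-2)/2) ≤ C := by
  have hn' : (1:ℝ) ≤ n := by exact_mod_cast hn
  set α : ℝ := (n:ℝ)*(q-2)/2 with hα
  have hα0 : 0 < α := by
    rw [hα]; have : 0 < q - 2 := by linarith
    positivity
  set G := ∫ l : Euc n, rexp (-(1/2) * ‖l‖^2) with hG
  set R := ∫ l : Euc n, rexp (-(1/(2*q)) * ‖l‖^q) * ‖l‖^α with hR
  have hG0 : 0 ≤ G := integral_nonneg fun _ => by positivity
  have hR0 : 0 ≤ R := integral_nonneg fun _ => by positivity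
  have hRi : Integrable (fun l : Euc n => rexp (-(1/(2*q)) * ‖l‖^q) * ‖l‖^α) :=
    int_rad hn (by linarith) (by positivity) hα0.le
  refine ⟨(2*q)^α * G + R + 1, by positivity, fun m => ?_⟩
  -- the integrable majorant of the near part
  obtain ⟨F, hFi, hFint, hF0, hFb⟩ : ∃ F : Euc n → ℝ, Integrable F ∧ ∫ l, F l ≤ (2*q)^α * G ∧
      (∀ l, 0 ≤ F l) ∧ ∀ l, ‖l‖ ≤ 2*q*‖m‖ → rexp (-DD q m l) * ‖l‖^α ≤ F l := by
    rcases (norm_nonneg m).eq_or_lt with hm | hm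
    · refine ⟨fun _ => 0, integrable_zero _ _ _, by simpa using by positivity, fun _ => le_rfl,
        fun l hl => ?_⟩
      rw [← hm, mul_zero] at hl
      rw [le_antisymm hl (norm_nonneg l), zero_rpow hα0.ne', mul_zero]
    · have hs : 0 < ‖m‖^((q-2)/2) := rpow_pos_of_pos hm _
      have e1 : (‖m‖^((q-2)/2))^2 = ‖m‖^(q-2) := by
        rw [← rpow_natCast, ← rpow_mul hm.le]; congr 1; push_cast; ring
      have e2 : (‖m‖^((q-2)/2))^n = ‖m‖^α := by
        rw [← rpow_natCast, ← rpow_mul hm.le]; congr 1; rw [hα]; ring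
      obtain ⟨g1, g2⟩ := gauss_scaled (n := n) hs m
      rw [e1] at g1 g2
      rw [e2] at g2
      refine ⟨fun l => ((2*q)^α * ‖m‖^α) * rexp (-(‖m‖^(q-2) * ‖l - m‖^2 / 2)),
        g1.const_mul _, ?_, fun l => by positivity, fun l hl => ?_⟩
      · rw [integral_const_mul, mul_assoc, g2]
      · rw [mul_comm]
        have h1 : ‖l‖^α ≤ (2*q)^α * ‖m‖^α := by
          rw [← mul_rpow (by linarith) hm.le]
          exact rpow_le_rpow (norm_nonneg _) hl hα0.le
        have h2 := DD_lower hq m l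
        exact mul_le_mul h1 (Real.exp_le_exp.2 (by linarith)) (by positivity) (by positivity)
  have hb : ∀ l, rexp (-DD q m l) * ‖l‖^α ≤ F l + rexp (-(1/(2*q)) * ‖l‖^q) * ‖l‖^α := by
    intro l
    rcases le_total ‖l‖ (2*q*‖m‖) with hl | hl
    · have := hFb l hl
      have : 0 ≤ rexp (-(1/(2*q)) * ‖l‖^q) * ‖l‖^α := by positivity
      linarith
    · have h1 := DD_far hq m l hl
      have h2 : rexp (-DD q m l) * ‖l‖^α ≤ rexp (-(1/(2*q)) * ‖l‖^q) * ‖l‖^α := by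
        have : -DD q m l ≤ -(1/(2*q)) * ‖l‖^q := by
          have : -(1/(2*q)) * ‖l‖^q = -(‖l‖^q/(2*q)) := by ring
          linarith
        gcongr
      linarith [hF0 l]
  have hi : Integrable (fun l : Euc n => rexp (-DD q m l) * ‖l‖^α) := by
    refine (hFi.add hRi).mono' ?_ (Eventually.of_forall fun l => ?_)
    · have c1 : Continuous (fun l : Euc n => ‖l‖^α) :=
        continuous_norm.rpow_const (fun _ => Or.inr hα0.le)
      have c2 := DD_cont hq m
      exact (Continuous.mul (by fun_prop) c1).aestronglyMeasurable
    · rw [Real.norm_of_nonneg (by positivity)]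
      exact hb l
  refine ⟨hi, ?_⟩
  calc _ ≤ ∫ l, (F l + rexp (-(1/(2*q)) * ‖l‖^q) * ‖l‖^α) := integral_mono hi (hFi.add hRi) hb
    _ = (∫ l, F l) + R := integral_add hFi hRi
    _ ≤ _ := by linarith

lemma core_lower {n : ℕ} (hn : 1 ≤ n) {q : ℝ} (hq : 2 < q) :
    ∃ c > (0:ℝ), ∀ m : Euc n,
      Integrable (fun l : Euc n => rexp (-DD q m l) * ‖l‖^((n:ℝ)*(q-2)/2)) →
      c ≤ ∫ l : Euc n, rexp (-DD q m l) * ‖l‖^((n:ℝ)*(q-2)/2) := by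
  have hn' : (1:ℝ) ≤ n := by exact_mod_cast hn
  set α : ℝ := (n:ℝ)*(q-2)/2 with hα
  have hα0 : 0 < α := by
    rw [hα]; have : 0 < q - 2 := by linarith
    positivity
  set V := volume.real (Metric.ball (0 : Euc n) 1) with hV
  have hV0 : 0 < V := by
    rw [hV, measureReal_def]
    exact ENNReal.toReal_pos (Metric.measure_ball_pos _ _ one_pos).ne' measure_ball_lt_top.ne
  set K := (q-1)*2^(q-2) + 1 with hK
  have hK0 : 0 < K := by
    have : 0 < q - 1 := by linarith
    positivity
  refine ⟨min ((rexp (-3) * (1/4)^α) * ((1/4)^n * V)) (rexp (-K) * (1/2)^α * ((1/2)^n * V)),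
    by positivity, fun m hi => ?_⟩
  have h0 : ∀ l : Euc n, 0 ≤ rexp (-DD q m l) * ‖l‖^α := fun l => by positivity
  rcases le_total ‖m‖ 1 with hm | hm
  · refine (min_le_left _ _).trans ?_
    refine ball_lower hn hi h0 (EuclideanSpace.single (⟨0, by omega⟩ : Fin n) (1/2 : ℝ)) (by norm_num)
      fun l hl => ?_
    rw [mem_ball_iff_norm] at hl
    have hc : ‖(EuclideanSpace.single (⟨0, by omega⟩ : Fin n) (1/2 : ℝ) : Euc n)‖ = 1/2 := by
      simp
    have h1 := (abs_le.1 (abs_norm_sub_norm_le l (EuclideanSpace.single (⟨0, by omega⟩ : Fin n) (1/2 : ℝ))))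
    rw [hc] at h1
    have h2 : 1/4 ≤ ‖l‖ := by linarith [h1.1]
    have h3 := DD_small hq m l hm (by linarith [h1.2])
    gcongr
  · refine (min_le_right _ _).trans ?_
    have hm0 : 0 < ‖m‖ := by linarith
    set s := ‖m‖^((q-2)/2) with hs
    have hs0 : 0 < s := rpow_pos_of_pos hm0 _
    have hs1 : 1 ≤ s := one_le_rpow hm (by linarith)
    have e1 : s^2 = ‖m‖^(q-2) := by
      rw [hs, ← rpow_natCast, ← rpow_mul hm0.le]; congr 1; push_cast; ring
    have e2 : s^n = ‖m‖^α := by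
      rw [hs, ← rpow_natCast, ← rpow_mul hm0.le]; congr 1; rw [hα]; ring
    have hr : (1/2)*s⁻¹ ≤ 1/2 := by
      have := inv_le_one_of_one_le₀ hs1
      linarith
    have key := ball_lower hn hi h0 m (r := (1/2)*s⁻¹) (k := rexp (-K) * ((1/2)^α * s^n))
      (by positivity) fun l hl => by
        rw [mem_ball_iff_norm] at hl
        have h1 := (abs_le.1 (abs_norm_sub_norm_le l m))
        have h2 : 1/2 * ‖m‖ ≤ ‖l‖ := by linarith [h1.1]
        have h3 := DD_upper hq m l (by linarith [h1.2])
        have h4 : ‖m‖^(q-2) * ‖l - m‖^2 ≤ 1 := by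
          rw [← e1, ← mul_pow]
          refine pow_le_one₀ (by positivity) ?_
          calc s * ‖l - m‖ ≤ s * ((1/2)*s⁻¹) := by gcongr
            _ = 1/2 := by field_simp
            _ ≤ 1 := by norm_num
        have h5 : DD q m l ≤ K := h3.trans (mul_le_of_le_one_right hK0.le h4)
        have h6 : (1/2)^α * s^n ≤ ‖l‖^α := by
          rw [e2, ← mul_rpow (by norm_num) hm0.le]
          exact rpow_le_rpow (by positivity) h2 hα0.le
        gcongr
    refine le_trans (le_of_eq ?_) key
    rw [mul_pow, inv_pow, ← hV]
    field_simp

lemma exists_dual {n : ℕ} {p q : ℝ} (hp1 : 1 < p) (hp2 : p < 2) (hpq : 1/p + 1/q = 1) (y : Euc n) :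
    ∃ m : Euc n, ‖m‖^(q-2) • m = y ∧ ‖m‖^q = ‖y‖^p := by
  have hq : q * (p-1) = p := by
    have : q ≠ 0 := by
      rintro rfl
      simp at hpq; linarith
    have hp : p ≠ 0 := by linarith
    field_simp at hpq
    linarith
  rcases eq_or_ne y 0 with rfl | hy
  · have hq0 : q ≠ 0 := by rintro rfl; linarith
    refine ⟨0, by simp, ?_⟩
    rw [norm_zero, zero_rpow hq0, zero_rpow (by linarith)]
  · have hy : 0 < ‖y‖ := norm_pos_iff.2 hy
    have hm : ‖‖y‖^(p-2) • y‖ = ‖y‖^(p-1) := by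
      rw [norm_smul, Real.norm_of_nonneg (by positivity), ← rpow_add_one hy.ne']; congr 1; ring
    refine ⟨‖y‖^(p-2) • y, ?_, ?_⟩
    · rw [hm, smul_smul, ← rpow_mul hy.le, ← rpow_add hy]
      have : (p-1)*(q-2) + (p-2) = 0 := by linarith
      rw [this, rpow_zero, one_smul]
    · rw [hm, ← rpow_mul hy.le]; congr 1; linarith

/-- **Two-sided integral form of Legendre duality** (identity (4.21) in the paper):
`e^{γ|x|^p/p} ≃ ∫ e^{γ^{1/p}λ·x − |λ|^q/q} |λ|^{n(q-2)/2} dλ`, uniformly in `γ ≥ 1`. -/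
theorem legendre_duality_integral
    (n : ℕ) (hn : 1 ≤ n) (p q : ℝ) (hp1 : 1 < p) (hp2 : p < 2) (hpq : 1/p + 1/q = 1) :
    ∃ c₁ > (0:ℝ), ∃ c₂ > (0:ℝ), ∀ γ : ℝ, 1 ≤ γ → ∀ x : Euc n,
      c₁ * Real.exp (γ * ‖x‖^p / p)
          ≤ (∫ lam : Euc n,
              Real.exp (γ^(1/p) * (∑ j, lam j * x j) - ‖lam‖^q/q)
                * ‖lam‖^((n:ℝ)*(q-2)/2)) ∧
      (∫ lam : Euc n,
          Real.exp (γ^(1/p) * (∑ j, lam j * x j) - ‖lam‖^q/q)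
            * ‖lam‖^((n:ℝ)*(q-2)/2))
        ≤ c₂ * Real.exp (γ * ‖x‖^p / p) := by
  have hp0 : 0 < p := by linarith
  have hq : 2 < q := by
    have h1 : 1/q = 1 - 1/p := by linarith
    have h2 : 1/2 < 1/p := one_div_lt_one_div_of_lt hp0 hp2
    have h3 : 1/p < 1 := by rw [div_lt_one hp0]; exact hp1
    have hq0 : 0 < q := one_div_pos.1 (by linarith)
    exact (one_div_lt_one_div hq0 (by norm_num)).1 (by linarith)
  obtain ⟨C, hC, hU⟩ := core_upper hn hq
  obtain ⟨c, hc, hL⟩ := core_lower hn hq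
  refine ⟨c, hc, C, hC, fun γ hγ x => ?_⟩
  have hγ0 : 0 ≤ γ := by linarith
  obtain ⟨m, hm1, hm2⟩ := exists_dual hp1 hp2 hpq (γ^(1/p) • x)
  have hy : ‖γ^(1/p) • x‖^p = γ * ‖x‖^p := by
    rw [norm_smul, Real.norm_of_nonneg (by positivity), mul_rpow (by positivity) (norm_nonneg _),
      ← rpow_mul hγ0, one_div_mul_cancel hp0.ne', rpow_one]
  rw [hy] at hm2
  have e : ∀ l : Euc n, Real.exp (γ^(1/p) * (∑ j, l j * x j) - ‖l‖^q/q) * ‖l‖^((n:ℝ)*(q-2)/2)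
      = Real.exp (γ * ‖x‖^p / p) * (Real.exp (-DD q m l) * ‖l‖^((n:ℝ)*(q-2)/2)) := by
    intro l
    have hin : γ^(1/p) * (∑ j, l j * x j) = ‖m‖^(q-2) * inner ℝ l m := by
      rw [← real_inner_smul_right, hm1, real_inner_smul_right]
      congr 1
      simp [PiLp.inner_apply, mul_comm]
    rw [← mul_assoc, ← Real.exp_add, hin]
    congr 2
    unfold DD
    have : 1 - 1/q = 1/p := by linarith
    rw [hm2, this]; ring
  simp_rw [e]
  rw [integral_const_mul]
  obtain ⟨hi, hu⟩ := hU m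
  have hl := hL m hi
  constructor
  · rw [mul_comm]; gcongr
  · rw [mul_comm C]; gcongr
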